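/- Let r0 ≥ 3 be an integer and U ∈ C^{r0}(ℝ^n, ℝ). Set Q_U(z) := D²U(0)(z,z) and assume: ω0|z|² ≤ Q_U(z) ≤ ω0^{−1}|z|² for all z, with ω0 ∈ (0,1); U(z) − U(0) − DU(0)(z) ≥ ω|z|² for all z, with 0 < ω ≤ ω0/8; and, with Ψ(t) := sup_{|z|≤t} Σ_{3 ≤ |α| ≤ r0} |∂^α U(z)|/α!, lim_{t→∞} t^{−2} ln Ψ(t) = 0. Set ζ̃ := ωω0/2 and, for w ∈ ℝ^n and β ≥ 1, define K_{w,β}(z) := exp( −β·( U(w + β^{−1/2}z) − U(w) − DU(w)(β^{−1/2}z) ) + Q_U(z)/2 ) − 1. Then there exist δ0 > 0 (depending only on ω, ω0 and Ψ(1)) and C1 > 0 (depending only on ω, r0 and the function Ψ) such that for all δ ∈ (0, δ0], all β ≥ 1 and all w with |w| ≤ δ: sup_{z∈ℝ^n} e^{−(1−ζ̃)Q_U(z)/2} · |K_{w,β}|_{T_z} ≤ C1 (δ + β^{−1/2}). -/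

import Mathlib

open scoped BigOperators

/-- Partial derivative in the coordinate direction `i` on `EuclideanSpace ℝ ι`. -/
noncomputable def epd {ι : Type} [Fintype ι] [DecidableEq ι] (i : ι)
    (f : EuclideanSpace ℝ ι → ℝ) : EuclideanSpace ℝ ι → ℝ :=
  fun z => fderiv ℝ f z (EuclideanSpace.single i 1)

/-- Iterated partial derivative in one coordinate direction. -/
noncomputable def epdPow {ι : Type} [Fintype ι] [DecidableEq ι] (i : ι) :
    ℕ → (EuclideanSpace ℝ ι → ℝ) → EuclideanSpace ℝ ι → ℝ
  | 0, f => f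
  | k + 1, f => epd i (epdPow i k f)

/-- Multiindex partial derivative `∂^α` on `EuclideanSpace ℝ ι`. -/
noncomputable def epdMulti {ι : Type} [Fintype ι] [DecidableEq ι] (α : ι → ℕ)
    (f : EuclideanSpace ℝ ι → ℝ) : EuclideanSpace ℝ ι → ℝ :=
  (Finset.univ : Finset ι).toList.foldr (fun i g => epdPow i (α i) g) f

/-- Multiindex factorial `α!`. -/
def emfact {ι : Type} [Fintype ι] (α : ι → ℕ) : ℕ := ∏ i, Nat.factorial (α i)

/-- The quadratic form `z ↦ D²U(0)(z,z)`. -/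
noncomputable def equad0 {ι : Type} [Fintype ι] (U : EuclideanSpace ℝ ι → ℝ)
    (z : EuclideanSpace ℝ ι) : ℝ :=
  fderiv ℝ (fderiv ℝ U) 0 z z

/-- Truncated Taylor norm `|f|_{T_z} = ∑_{|α| ≤ r0} |∂^α f(z)|/α!` on `EuclideanSpace ℝ ι`. -/
noncomputable def etaylorNorm {ι : Type} [Fintype ι] [DecidableEq ι] (r0 : ℕ)
    (f : EuclideanSpace ℝ ι → ℝ) (z : EuclideanSpace ℝ ι) : ℝ :=
  ∑ α ∈ (Finset.Iic (fun _ : ι => r0)).filter (fun α => ∑ i, α i ≤ r0),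
    |epdMulti α f z| / ((emfact α : ℕ) : ℝ)

/-- The Mayer perturbation
`K_{w,β}(z) = exp(−β (U(w+β^{-1/2}z) − U(w) − DU(w)(β^{-1/2}z)) + Q_U(z)/2) − 1`. -/
noncomputable def Kpert {n : ℕ} (U : EuclideanSpace ℝ (Fin n) → ℝ)
    (w : EuclideanSpace ℝ (Fin n)) (β : ℝ) : EuclideanSpace ℝ (Fin n) → ℝ :=
  fun z => Real.exp (-β * (U (w + (Real.sqrt β)⁻¹ • z) - U w -
      fderiv ℝ U w ((Real.sqrt β)⁻¹ • z)) + equad0 U z / 2) - 1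

section PartialDerivatives

variable {ι : Type} [Fintype ι] [DecidableEq ι]

/-- The partial derivative along a list of coordinate directions. -/
noncomputable def pdList (L : List ι) (f : EuclideanSpace ℝ ι → ℝ) : EuclideanSpace ℝ ι → ℝ :=
  L.foldr epd f

/-- The `ℓ¹` sum of all order-`k` partial derivatives, counted over ordered tuples of directions. -/
noncomputable def pdSum : ℕ → (EuclideanSpace ℝ ι → ℝ) → EuclideanSpace ℝ ι → ℝ
  | 0, f, z => |f z|
  | k + 1, f, z => ∑ i, pdSum k (epd i f) z

theorem contDiff_epd {f : EuclideanSpace ℝ ι → ℝ} {m : ℕ}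
    (hf : ContDiff ℝ (m + 1 : ℕ) f) (i : ι) : ContDiff ℝ m (epd i f) :=
  (hf.fderiv_right (m := m) (by norm_cast)).clm_apply contDiff_const

theorem contDiff_pdList (L : List ι) {f : EuclideanSpace ℝ ι → ℝ} {m : ℕ}
    (hf : ContDiff ℝ (m + L.length : ℕ) f) : ContDiff ℝ m (pdList L f) := by
  induction L generalizing m with
  | nil => simpa [pdList] using hf
  | cons i L ih =>
    have h : ContDiff ℝ (m + 1 : ℕ) (pdList L f) := ih (by
      rwa [show m + 1 + L.length = m + (i :: L).length by simp; omega])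
    exact contDiff_epd h i

theorem epd_epd_apply {f : EuclideanSpace ℝ ι → ℝ} (hf : ContDiff ℝ (2 : ℕ) f) (i j : ι)
    (z : EuclideanSpace ℝ ι) : epd i (epd j f) z =
      fderiv ℝ (fderiv ℝ f) z (EuclideanSpace.single i 1) (EuclideanSpace.single j 1) := by
  have hd : DifferentiableAt ℝ (fderiv ℝ f) z :=
    (hf.fderiv_right (m := 1) (by norm_cast)).differentiable (by norm_num) z
  change fderiv ℝ (fun z => fderiv ℝ f z (EuclideanSpace.single j 1)) z _ = _
  rw [fderiv_clm_apply hd (by fun_prop)]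
  simp

theorem epd_comm {f : EuclideanSpace ℝ ι → ℝ} (hf : ContDiff ℝ (2 : ℕ) f) (i j : ι) :
    epd i (epd j f) = epd j (epd i f) := by
  funext z
  rw [epd_epd_apply hf, epd_epd_apply hf]
  exact (hf.contDiffAt.isSymmSndFDerivAt (by simp)) _ _

theorem pdList_perm {L L' : List ι} (h : L.Perm L') {f : EuclideanSpace ℝ ι → ℝ}
    (hf : ContDiff ℝ L.length f) : pdList L f = pdList L' f := by
  induction h with
  | nil => rfl
  | @cons i L L' h ih =>
    have := ih (hf.of_le (by simp))
    exact congrArg (epd i) this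
  | swap i j L =>
    exact epd_comm (contDiff_pdList L (by rwa [show 2 + L.length = (j :: i :: L).length by simp; omega])) j i
  | trans h₁ h₂ ih₁ ih₂ =>
    rw [ih₁ hf, ih₂ (by rwa [← h₁.length_eq])]

/-- The list of directions in which `∂^α` differentiates. -/
noncomputable def multiList (α : ι → ℕ) : List ι :=
  (Finset.univ : Finset ι).toList.flatMap fun i => List.replicate (α i) i

theorem epdPow_eq_pdList (i : ι) (k : ℕ) (f : EuclideanSpace ℝ ι → ℝ) :
    epdPow i k f = pdList (List.replicate k i) f := by
  induction k with
  | zero => rfl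
  | succ k ih => simp only [epdPow, ih, List.replicate_succ, pdList, List.foldr_cons]

theorem epdMulti_eq_pdList (α : ι → ℕ) (f : EuclideanSpace ℝ ι → ℝ) :
    epdMulti α f = pdList (multiList α) f := by
  unfold epdMulti multiList
  generalize (Finset.univ : Finset ι).toList = L
  induction L with
  | nil => rfl
  | cons i L ih =>
    rw [List.foldr_cons, ih, epdPow_eq_pdList, List.flatMap_cons]
    simp [pdList]

theorem count_multiList (α : ι → ℕ) (i : ι) : (multiList α).count i = α i := by
  rw [multiList, List.count_flatMap]
  simp only [Function.comp_def, List.count_replicate]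
  rw [Finset.sum_map_toList]
  simp

omit [DecidableEq ι] in
theorem length_multiList (α : ι → ℕ) : (multiList α).length = ∑ i, α i := by
  rw [multiList, List.length_flatMap]
  simp only [List.length_replicate]
  exact Finset.sum_map_toList _ _

theorem epdMulti_epd {f : EuclideanSpace ℝ ι → ℝ} (α : ι → ℕ) (i : ι)
    (hf : ContDiff ℝ (∑ j, α j + 1 : ℕ) f) :
    epdMulti α (epd i f) = epdMulti (α + Pi.single i 1) f := by
  have h : pdList (multiList α) (epd i f) = pdList (multiList α ++ [i]) f := by simp [pdList]
  rw [epdMulti_eq_pdList, epdMulti_eq_pdList, h]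
  refine pdList_perm (List.perm_iff_count.2 fun j => ?_) (by simpa [length_multiList] using hf)
  rw [List.count_append, count_multiList, count_multiList, List.count_singleton]
  by_cases hij : i = j
  · subst hij; simp
  · simp [hij, Ne.symm hij]

theorem emfact_add_single (α : ι → ℕ) (i : ι) :
    emfact (α + Pi.single i 1) = (α i + 1) * emfact α := by
  unfold emfact
  rw [← Finset.mul_prod_erase _ _ (Finset.mem_univ i),
    ← Finset.mul_prod_erase _ (fun j => (α j).factorial) (Finset.mem_univ i), ← mul_assoc]
  congr 1
  · simp [Nat.factorial_succ]
  · refine Finset.prod_congr rfl fun j hj => ?_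
    simp [Finset.ne_of_mem_erase hj]

omit [DecidableEq ι] in
theorem emfact_pos (α : ι → ℕ) : 0 < emfact α :=
  Finset.prod_pos fun _ _ => Nat.factorial_pos _

theorem sum_piAntidiag_add_single (F : (ι → ℕ) → ℝ) (k : ℕ) (i : ι) :
    ∑ α ∈ Finset.piAntidiag Finset.univ k, F (α + Pi.single i 1) / (emfact α : ℝ) =
      ∑ γ ∈ Finset.piAntidiag Finset.univ (k + 1), γ i * (F γ / (emfact γ : ℝ)) := by
  symm
  rw [← Finset.sum_filter_of_ne (p := fun γ : ι → ℕ => γ i ≠ 0)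
    (fun γ _ h h0 => h (by simp [h0]))]
  have hadd : ∀ γ : ι → ℕ, γ i ≠ 0 → γ - Pi.single i 1 + Pi.single i 1 = γ := by
    intro γ h
    funext j
    by_cases hj : j = i
    · subst hj; simp; omega
    · simp [hj]
  refine Finset.sum_nbij' (fun γ => γ - Pi.single i 1) (fun α => α + Pi.single i 1)
    ?_ ?_ ?_ ?_ ?_
  · intro γ hγ
    simp only [Finset.mem_filter, Finset.mem_piAntidiag] at hγ ⊢
    have h : ∑ j, (γ - Pi.single i 1 : ι → ℕ) j + 1 = ∑ j, γ j := by
      conv_rhs => rw [← hadd γ hγ.2]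
      simp only [Pi.add_apply, Finset.sum_add_distrib, Finset.sum_pi_single', Finset.mem_univ,
        if_true]
    exact ⟨Nat.succ_injective (h.trans hγ.1.1), fun j _ => Finset.mem_univ j⟩
  · intro α hα
    simp only [Finset.mem_filter, Finset.mem_piAntidiag] at hα ⊢
    refine ⟨⟨?_, fun j _ => Finset.mem_univ j⟩, by simp⟩
    simp [Finset.sum_add_distrib, hα.1]
  · intro γ hγ
    exact hadd γ (Finset.mem_filter.1 hγ).2
  · intro α _
    simp
  · intro γ hγ
    have h := (Finset.mem_filter.1 hγ).2
    set α := γ - Pi.single i 1 with hα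
    have hγα : γ = α + Pi.single i 1 := (hadd γ h).symm
    rw [hγα, emfact_add_single]
    have : (emfact α : ℝ) ≠ 0 := by exact_mod_cast (emfact_pos α).ne'
    simp
    field_simp

theorem pdSum_eq_sum_epdMulti {k : ℕ} {f : EuclideanSpace ℝ ι → ℝ} (hf : ContDiff ℝ k f)
    (z : EuclideanSpace ℝ ι) :
    pdSum k f z = k.factorial *
      ∑ α ∈ Finset.piAntidiag Finset.univ k, |epdMulti α f z| / (emfact α : ℝ) := by
  induction k generalizing f with
  | zero =>
    have h : multiList (0 : ι → ℕ) = [] :=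
      List.eq_nil_of_length_eq_zero (by simp [length_multiList])
    simp [pdSum, epdMulti_eq_pdList, h, pdList, emfact]
  | succ k ih =>
    have h : ∀ i, ∑ α ∈ Finset.piAntidiag Finset.univ k,
        |epdMulti α (epd i f) z| / (emfact α : ℝ) = ∑ γ ∈ Finset.piAntidiag Finset.univ (k + 1),
          γ i * (|epdMulti γ f z| / (emfact γ : ℝ)) := by
      intro i
      rw [← sum_piAntidiag_add_single (fun γ => |epdMulti γ f z|)]
      refine Finset.sum_congr rfl fun α hα => ?_
      rw [epdMulti_epd α i (by rwa [(Finset.mem_piAntidiag.1 hα).1])]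
    simp only [pdSum]
    rw [Finset.sum_congr rfl fun i _ => ih (contDiff_epd hf i)]
    simp only [h]
    rw [← Finset.mul_sum, Finset.sum_comm, Nat.factorial_succ, mul_comm (k + 1), Nat.cast_mul,
      mul_assoc, Finset.mul_sum (a := ((k + 1 : ℕ) : ℝ))]
    congr 1
    refine Finset.sum_congr rfl fun γ hγ => ?_
    rw [← Finset.sum_mul, ← (Finset.mem_piAntidiag.1 hγ).1]
    push_cast
    rfl

theorem pdSum_nonneg (k : ℕ) (f : EuclideanSpace ℝ ι → ℝ) (z : EuclideanSpace ℝ ι) :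
    0 ≤ pdSum k f z := by
  induction k generalizing f with
  | zero => exact abs_nonneg _
  | succ k ih => exact Finset.sum_nonneg fun i _ => ih _

theorem etaylorNorm_le_sum_pdSum {r : ℕ} {f : EuclideanSpace ℝ ι → ℝ} (hf : ContDiff ℝ r f)
    (z : EuclideanSpace ℝ ι) :
    etaylorNorm r f z ≤ ∑ k ∈ Finset.range (r + 1), pdSum k f z := by
  unfold etaylorNorm
  rw [← Finset.sum_fiberwise_of_maps_to (t := Finset.range (r + 1)) (g := fun α : ι → ℕ => ∑ i, α i)
    (fun α hα => by simp at hα ⊢; omega)]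
  refine Finset.sum_le_sum fun k hk => ?_
  have hk' : k ≤ r := by simpa [Nat.lt_succ_iff] using hk
  have hnn : ∀ α : ι → ℕ, 0 ≤ |epdMulti α f z| / (emfact α : ℝ) := fun α => by positivity
  rw [pdSum_eq_sum_epdMulti (hf.of_le (by exact_mod_cast hk'))]
  refine (Finset.sum_le_sum_of_subset_of_nonneg (t := Finset.piAntidiag Finset.univ k) ?_
    fun α _ _ => hnn α).trans ?_
  · intro α hα
    simp only [Finset.mem_filter] at hα
    simp [Finset.mem_piAntidiag, hα.2]
  · exact le_mul_of_one_le_left (Finset.sum_nonneg fun α _ => hnn α)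
      (by exact_mod_cast Nat.succ_le_of_lt k.factorial_pos)

theorem pdSum_le_sum_epdMulti {r k : ℕ} (hk : 3 ≤ k) (hkr : k ≤ r)
    {f : EuclideanSpace ℝ ι → ℝ} (hf : ContDiff ℝ r f) (z : EuclideanSpace ℝ ι) :
    pdSum k f z ≤ k.factorial *
      ∑ α ∈ (Finset.Iic (fun _ : ι => r)).filter (fun α => 3 ≤ ∑ i, α i ∧ ∑ i, α i ≤ r),
        |epdMulti α f z| / ((emfact α : ℕ) : ℝ) := by
  have hnn : ∀ α : ι → ℕ, 0 ≤ |epdMulti α f z| / (emfact α : ℝ) := fun α => by positivity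
  rw [pdSum_eq_sum_epdMulti (hf.of_le (by exact_mod_cast hkr))]
  refine mul_le_mul_of_nonneg_left
    (Finset.sum_le_sum_of_subset_of_nonneg ?_ fun α _ _ => hnn α) (by positivity)
  intro α hα
  have h := (Finset.mem_piAntidiag.1 hα).1
  simp only [Finset.mem_filter, Finset.mem_Iic, h, hk, hkr, and_self, and_true]
  intro i
  exact (Finset.single_le_sum (fun _ _ => Nat.zero_le _) (Finset.mem_univ i)).trans (h.le.trans hkr)

theorem epd_add {f g : EuclideanSpace ℝ ι → ℝ} (hf : Differentiable ℝ f)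
    (hg : Differentiable ℝ g) (i : ι) :
    epd i (fun z => f z + g z) = fun z => epd i f z + epd i g z := by
  funext z
  simp only [epd]
  rw [fderiv_fun_add (hf z) (hg z)]
  rfl

theorem epd_mul {f g : EuclideanSpace ℝ ι → ℝ} (hf : Differentiable ℝ f)
    (hg : Differentiable ℝ g) (i : ι) :
    epd i (fun z => f z * g z) = fun z => epd i f z * g z + f z * epd i g z := by
  funext z
  simp only [epd]
  rw [fderiv_fun_mul (hf z) (hg z)]
  simp
  ring

omit [DecidableEq ι] in
theorem differentiable_of_contDiff_succ {f : EuclideanSpace ℝ ι → ℝ} {k : ℕ}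
    (hf : ContDiff ℝ (k + 1 : ℕ) f) : Differentiable ℝ f :=
  hf.differentiable (by norm_cast)

theorem pdSum_add_le {k : ℕ} {f g : EuclideanSpace ℝ ι → ℝ} (hf : ContDiff ℝ k f)
    (hg : ContDiff ℝ k g) (z : EuclideanSpace ℝ ι) :
    pdSum k (fun z => f z + g z) z ≤ pdSum k f z + pdSum k g z := by
  induction k generalizing f g with
  | zero => exact abs_add_le _ _
  | succ k ih =>
    simp only [pdSum]
    rw [← Finset.sum_add_distrib]
    refine Finset.sum_le_sum fun i _ => ?_
    rw [epd_add (differentiable_of_contDiff_succ hf) (differentiable_of_contDiff_succ hg)]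
    exact ih (contDiff_epd hf i) (contDiff_epd hg i)

theorem pdSum_mul_le {k : ℕ} {f g : EuclideanSpace ℝ ι → ℝ} (hf : ContDiff ℝ k f)
    (hg : ContDiff ℝ k g) (z : EuclideanSpace ℝ ι) :
    pdSum k (fun z => f z * g z) z ≤
      ∑ p ∈ Finset.HasAntidiagonal.antidiagonal k, (k.choose p.1 : ℝ) * (pdSum p.1 f z * pdSum p.2 g z) := by
  induction k generalizing f g with
  | zero => simp [pdSum, abs_mul]
  | succ k ih =>
    have hk : ((k : ℕ) : WithTop ℕ∞) ≤ (k + 1 : ℕ) := by exact_mod_cast Nat.le_succ k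
    have hfg : ∀ i, pdSum k (epd i fun z => f z * g z) z ≤
        ∑ p ∈ Finset.HasAntidiagonal.antidiagonal k, (k.choose p.1 : ℝ) * (pdSum p.1 (epd i f) z * pdSum p.2 g z) +
        ∑ p ∈ Finset.HasAntidiagonal.antidiagonal k,
          (k.choose p.1 : ℝ) * (pdSum p.1 f z * pdSum p.2 (epd i g) z) := by
      intro i
      rw [epd_mul (differentiable_of_contDiff_succ hf) (differentiable_of_contDiff_succ hg)]
      refine (pdSum_add_le ((contDiff_epd hf i).mul (hg.of_le hk))
        ((hf.of_le hk).mul (contDiff_epd hg i)) z).trans (add_le_add ?_ ?_)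
      · exact ih (contDiff_epd hf i) (hg.of_le hk)
      · exact ih (hf.of_le hk) (contDiff_epd hg i)
    rw [Finset.sum_antidiagonal_choose_succ_mul fun a b => pdSum a f z * pdSum b g z]
    refine (Finset.sum_le_sum fun i _ => hfg i).trans (le_of_eq ?_)
    rw [Finset.sum_add_distrib, add_comm]
    congr 1
    · rw [Finset.sum_comm]
      refine Finset.sum_congr rfl fun p _ => ?_
      simp only [pdSum, Finset.mul_sum]
    · rw [Finset.sum_comm]
      refine Finset.sum_congr rfl fun p hp => ?_
      simp only [pdSum, Finset.mul_sum, Finset.sum_mul]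
      rw [← Finset.HasAntidiagonal.mem_antidiagonal.1 hp, Nat.choose_symm_add]

theorem epd_exp {f : EuclideanSpace ℝ ι → ℝ} (hf : Differentiable ℝ f) (i : ι) :
    epd i (fun z => Real.exp (f z)) = fun z => epd i f z * Real.exp (f z) := by
  funext z
  simp only [epd]
  rw [fderiv_exp (hf z)]
  simp [mul_comm]

theorem pdSum_succ_exp_le_of_le {k : ℕ} {f : EuclideanSpace ℝ ι → ℝ}
    (hf : ContDiff ℝ (k + 1 : ℕ) f) {z : EuclideanSpace ℝ ι} {M : ℝ} (hM : 0 ≤ M)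
    (hfM : ∀ j ≤ k, pdSum (j + 1) f z ≤ M)
    (hexp : ∀ j ≤ k, pdSum j (fun z => Real.exp (f z)) z ≤
      j.factorial * (1 + M) ^ j * Real.exp (f z)) :
    pdSum (k + 1) (fun z => Real.exp (f z)) z ≤
      (k + 1).factorial * (M * (1 + M) ^ k) * Real.exp (f z) := by
  have hk : ((k : ℕ) : WithTop ℕ∞) ≤ (k + 1 : ℕ) := by exact_mod_cast Nat.le_succ k
  have h1 : pdSum (k + 1) (fun z => Real.exp (f z)) z ≤ ∑ p ∈ Finset.HasAntidiagonal.antidiagonal k,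
      (k.choose p.1 : ℝ) * (pdSum (p.1 + 1) f z * pdSum p.2 (fun z => Real.exp (f z)) z) := by
    simp only [pdSum, Finset.sum_mul, Finset.mul_sum]
    rw [Finset.sum_comm]
    refine Finset.sum_le_sum fun i _ => ?_
    rw [epd_exp (differentiable_of_contDiff_succ hf)]
    exact pdSum_mul_le (contDiff_epd hf i) (hf.of_le hk).exp z
  refine h1.trans ?_
  have h2 : ∀ p ∈ Finset.HasAntidiagonal.antidiagonal k,
      (k.choose p.1 : ℝ) * (pdSum (p.1 + 1) f z * pdSum p.2 (fun z => Real.exp (f z)) z) ≤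
      k.factorial * (M * (1 + M) ^ k) * Real.exp (f z) := by
    intro p hp
    have hp' := Finset.HasAntidiagonal.mem_antidiagonal.1 hp
    have hc : ((k.choose p.1 : ℕ) : ℝ) * p.2.factorial ≤ k.factorial := by
      have h := Nat.choose_mul_factorial_mul_factorial (n := k) (k := p.1) (by omega)
      rw [show k - p.1 = p.2 by omega] at h
      have : k.choose p.1 * p.2.factorial ≤ k.factorial := by
        rw [← h, mul_right_comm]
        exact Nat.le_mul_of_pos_right _ p.1.factorial_pos
      exact_mod_cast this
    calc _ ≤ (k.choose p.1 : ℝ) * (M * (p.2.factorial * (1 + M) ^ k * Real.exp (f z))) := by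
          gcongr
          · exact pdSum_nonneg _ _ _
          · exact hfM _ (by omega)
          · refine (hexp _ (by omega)).trans ?_
            gcongr
            · linarith
            · omega
      _ = ((k.choose p.1 : ℝ) * p.2.factorial) * ((M * (1 + M) ^ k) * Real.exp (f z)) := by ring
      _ ≤ k.factorial * ((M * (1 + M) ^ k) * Real.exp (f z)) := by gcongr
      _ = _ := by ring
  refine (Finset.sum_le_card_nsmul _ _ _ h2).trans (le_of_eq ?_)
  rw [Finset.Nat.card_antidiagonal, nsmul_eq_mul, Nat.factorial_succ]
  push_cast
  ring

theorem pdSum_succ_exp_le {r : ℕ} {f : EuclideanSpace ℝ ι → ℝ}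
    (hf : ContDiff ℝ r f) {z : EuclideanSpace ℝ ι} {M : ℝ} (hM : 0 ≤ M)
    (hfM : ∀ j < r, pdSum (j + 1) f z ≤ M) {k : ℕ} (hk : k < r) :
    pdSum (k + 1) (fun z => Real.exp (f z)) z ≤
      (k + 1).factorial * (M * (1 + M) ^ k) * Real.exp (f z) := by
  induction k using Nat.strong_induction_on with
  | _ k ih =>
    refine pdSum_succ_exp_le_of_le (hf.of_le (by exact_mod_cast hk)) hM
      (fun j hj => hfM j (by omega)) fun j hj => ?_
    cases j with
    | zero => simp [pdSum]
    | succ j =>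
      refine (ih j (by omega) (by omega)).trans ?_
      rw [pow_succ' (1 + M)]
      gcongr
      linarith

theorem epd_const_mul_comp_affine {f : EuclideanSpace ℝ ι → ℝ} (hf : Differentiable ℝ f)
    (c ε : ℝ) (w : EuclideanSpace ℝ ι) (i : ι) :
    epd i (fun z => c * f (w + ε • z)) = fun z => c * ε * epd i f (w + ε • z) := by
  funext z
  have h1 : HasFDerivAt (fun z : EuclideanSpace ℝ ι => w + ε • z)
      (ε • ContinuousLinearMap.id ℝ (EuclideanSpace ℝ ι)) z :=
    ((hasFDerivAt_id z).const_smul ε).const_add w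
  have h2 : HasFDerivAt (fun z => c * f (w + ε • z)) (c • (fderiv ℝ f (w + ε • z)).comp
      (ε • ContinuousLinearMap.id ℝ (EuclideanSpace ℝ ι))) z :=
    ((hf (w + ε • z)).hasFDerivAt.comp z h1).const_mul c
  simp only [epd]
  rw [h2.fderiv]
  simp
  ring

theorem pdSum_const_mul_comp_affine {k : ℕ} {f : EuclideanSpace ℝ ι → ℝ} (hf : ContDiff ℝ k f)
    (c : ℝ) {ε : ℝ} (hε : 0 ≤ ε) (w z : EuclideanSpace ℝ ι) :
    pdSum k (fun z => c * f (w + ε • z)) z = |c| * ε ^ k * pdSum k f (w + ε • z) := by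
  induction k generalizing f c with
  | zero => simp [pdSum, abs_mul]
  | succ k ih =>
    simp only [pdSum, Finset.mul_sum]
    refine Finset.sum_congr rfl fun i _ => ?_
    rw [epd_const_mul_comp_affine (differentiable_of_contDiff_succ hf), ih (contDiff_epd hf i),
      abs_mul, abs_of_nonneg hε]
    ring

theorem epd_add_const (f : EuclideanSpace ℝ ι → ℝ) (c : ℝ) (i : ι) :
    epd i (fun z => f z + c) = epd i f := by
  funext z
  simp only [epd]
  rw [fderiv_add_const]

theorem abs_fderiv_le_pdSum (f : EuclideanSpace ℝ ι → ℝ) (z v : EuclideanSpace ℝ ι) :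
    |fderiv ℝ f z v| ≤ pdSum 1 f z * ‖v‖ := by
  have hv : v = ∑ i, v i • EuclideanSpace.single i (1 : ℝ) := by
    ext j
    simp [Finset.sum_apply, Pi.single_apply]
  conv_lhs => rw [hv]
  rw [map_sum]
  refine (Finset.abs_sum_le_sum_abs _ _).trans ?_
  simp only [pdSum, Finset.sum_mul]
  refine Finset.sum_le_sum fun i _ => ?_
  rw [map_smul, smul_eq_mul, abs_mul, mul_comm]
  exact mul_le_mul_of_nonneg_left (PiLp.norm_apply_le v i) (abs_nonneg _)

/-- Mean value inequality for a finite family of functions, in `ℓ¹` form. -/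
theorem sum_abs_sub_le {A : Type} [Fintype A] {f : A → EuclideanSpace ℝ ι → ℝ}
    (hf : ∀ a, Differentiable ℝ (f a)) {t C : ℝ}
    (hC : ∀ y, ‖y‖ ≤ t → ∑ a, pdSum 1 (f a) y ≤ C) {x : EuclideanSpace ℝ ι} (hx : ‖x‖ ≤ t) :
    ∑ a, |f a x - f a 0| ≤ C * ‖x‖ := by
  set σ : A → ℝ := fun a => SignType.sign (f a x - f a 0) with hσ
  have hσ1 : ∀ a, |σ a| ≤ 1 := by
    intro a
    simp only [hσ]
    rcases lt_trichotomy (f a x - f a 0) 0 with h | h | h <;> simp [h]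
  set g : EuclideanSpace ℝ ι → ℝ := fun y => ∑ a, σ a * f a y with hg
  have hgd : ∀ y, HasFDerivAt g (∑ a, σ a • fderiv ℝ (f a) y) y := fun y =>
    HasFDerivAt.fun_sum fun a _ => (hf a y).hasFDerivAt.const_mul (σ a)
  have hC0 : 0 ≤ C := (Finset.sum_nonneg fun a _ => pdSum_nonneg 1 (f a) x).trans (hC x hx)
  have hbound : ∀ y ∈ Metric.closedBall (0 : EuclideanSpace ℝ ι) t,
      ‖∑ a, σ a • fderiv ℝ (f a) y‖ ≤ C := by
    intro y hy
    refine ContinuousLinearMap.opNorm_le_bound _ hC0 fun v => ?_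
    rw [sum_apply, Real.norm_eq_abs]
    calc _ ≤ ∑ a, |(σ a • fderiv ℝ (f a) y) v| := Finset.abs_sum_le_sum_abs _ _
      _ ≤ ∑ a, pdSum 1 (f a) y * ‖v‖ := by
          refine Finset.sum_le_sum fun a _ => ?_
          rw [smul_apply, smul_eq_mul, abs_mul]
          exact (mul_le_of_le_one_left (abs_nonneg _) (hσ1 a)).trans (abs_fderiv_le_pdSum _ _ _)
      _ ≤ C * ‖v‖ := by
          rw [← Finset.sum_mul]
          gcongr
          exact hC y (by simpa using hy)
  have h0 : (0 : EuclideanSpace ℝ ι) ∈ Metric.closedBall (0 : EuclideanSpace ℝ ι) t := by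
    simpa using (norm_nonneg x).trans hx
  have key := Convex.norm_image_sub_le_of_norm_hasFDerivWithin_le
    (fun y _ => (hgd y).hasFDerivWithinAt) hbound (convex_closedBall _ t) h0
    (show x ∈ _ by simpa using hx)
  have heq : g x - g 0 = ∑ a, |f a x - f a 0| := by
    simp only [hg]
    rw [← Finset.sum_sub_distrib]
    refine Finset.sum_congr rfl fun a _ => ?_
    rw [← mul_sub, hσ]
    exact sign_mul_self _
  rw [heq, sub_zero] at key
  exact (le_abs_self _).trans key

/-- The exponent of `Kpert`, as a function of the scale `ε = β^{-1/2}`. -/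
noncomputable def mayerExponent (U : EuclideanSpace ℝ ι → ℝ) (w : EuclideanSpace ℝ ι) (ε : ℝ) :
    EuclideanSpace ℝ ι → ℝ :=
  fun z => -(ε ^ 2)⁻¹ * (U (w + ε • z) - U w - fderiv ℝ U w (ε • z)) + equad0 U z / 2

variable {U : EuclideanSpace ℝ ι → ℝ} {r : ℕ} {w : EuclideanSpace ℝ ι} {ε : ℝ}

omit [DecidableEq ι] in
theorem contDiff_equad0 (U : EuclideanSpace ℝ ι → ℝ) (m : WithTop ℕ∞) :
    ContDiff ℝ m (equad0 U) :=
  (fderiv ℝ (fderiv ℝ U) 0).contDiff.clm_apply contDiff_id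

omit [DecidableEq ι] in
theorem contDiff_mayerExponent (hU : ContDiff ℝ r U) (w : EuclideanSpace ℝ ι) (ε : ℝ) :
    ContDiff ℝ r (mayerExponent U w ε) := by
  have h1 : ContDiff ℝ r fun z : EuclideanSpace ℝ ι => U (w + ε • z) := hU.comp (by fun_prop)
  have h2 := contDiff_equad0 U r
  unfold mayerExponent
  fun_prop

omit [DecidableEq ι] in
theorem fderiv_fderiv_comm (hU : ContDiff ℝ r U) (hr : 3 ≤ r) (x y z : EuclideanSpace ℝ ι) :
    fderiv ℝ (fderiv ℝ U) z x y = fderiv ℝ (fderiv ℝ U) z y x :=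
  (hU.contDiffAt.isSymmSndFDerivAt (by
    simp only [minSmoothness_of_isRCLikeNormedField]
    exact_mod_cast (by omega : 2 ≤ r))) _ _

omit [DecidableEq ι] in
theorem fderiv_mayerExponent_apply (hU : ContDiff ℝ r U) (hr : 3 ≤ r) (hε : 0 < ε)
    (z v : EuclideanSpace ℝ ι) :
    fderiv ℝ (mayerExponent U w ε) z v = -ε⁻¹ * fderiv ℝ U (w + ε • z) v +
      (ε⁻¹ * fderiv ℝ U w v + fderiv ℝ (fderiv ℝ U) 0 z v) := by
  have hUd : Differentiable ℝ U := hU.differentiable (by exact_mod_cast (by omega : r ≠ 0))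
  have h1 : HasFDerivAt (fun z : EuclideanSpace ℝ ι => ε • z)
      (ε • ContinuousLinearMap.id ℝ (EuclideanSpace ℝ ι)) z := (hasFDerivAt_id z).const_smul ε
  have h2 : HasFDerivAt (fun z => U (w + ε • z)) ((fderiv ℝ U (w + ε • z)).comp
      (ε • ContinuousLinearMap.id ℝ (EuclideanSpace ℝ ι))) z :=
    (hUd (w + ε • z)).hasFDerivAt.comp z (h1.const_add w)
  have h3 : HasFDerivAt (fun z => fderiv ℝ U w (ε • z)) ((fderiv ℝ U w).comp
      (ε • ContinuousLinearMap.id ℝ (EuclideanSpace ℝ ι))) z :=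
    (fderiv ℝ U w).hasFDerivAt.comp z h1
  have h4 : HasFDerivAt (equad0 U) _ z :=
    (fderiv ℝ (fderiv ℝ U) 0).hasFDerivAt.clm_apply (hasFDerivAt_id z)
  have h5 := (((h2.sub_const (U w)).sub h3).const_mul (-(ε ^ 2)⁻¹)).add (h4.mul_const (2⁻¹ : ℝ))
  have h6 : fderiv ℝ (mayerExponent U w ε) z = _ := HasFDerivAt.fderiv h5
  rw [h6]
  simp [fderiv_fderiv_comm hU hr v z]
  field_simp
  ring

theorem epd_mayerExponent (hU : ContDiff ℝ r U) (hr : 3 ≤ r) (hε : 0 < ε) (i : ι) :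
    epd i (mayerExponent U w ε) = fun z => -ε⁻¹ * epd i U (w + ε • z) +
      (ε⁻¹ * epd i U w + fderiv ℝ (fderiv ℝ U) 0 z (EuclideanSpace.single i 1)) :=
  funext fun z => fderiv_mayerExponent_apply hU hr hε z _

theorem epd_epd_mayerExponent (hU : ContDiff ℝ r U) (hr : 3 ≤ r) (hε : 0 < ε) (i j : ι) :
    epd j (epd i (mayerExponent U w ε)) =
      fun z => -1 * epd j (epd i U) (w + ε • z) + epd j (epd i U) 0 := by
  have hUi : Differentiable ℝ (epd i U) :=
    (contDiff_epd (m := 1) (hU.of_le (by exact_mod_cast (by omega : 1 + 1 ≤ r))) i).differentiable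
      (by norm_num)
  rw [epd_mayerExponent hU hr hε]
  have hLd : Differentiable ℝ
      (fun z => ε⁻¹ * epd i U w + fderiv ℝ (fderiv ℝ U) 0 z (EuclideanSpace.single i 1)) := by
    fun_prop
  have hAd : Differentiable ℝ (fun z => -ε⁻¹ * epd i U (w + ε • z)) := by
    have := hUi.comp (g := epd i U) (f := fun z : EuclideanSpace ℝ ι => w + ε • z) (by fun_prop)
    exact this.const_mul _
  rw [epd_add hAd hLd, epd_const_mul_comp_affine hUi]
  funext z
  rw [epd_epd_apply (hU.of_le (by exact_mod_cast (by omega : 2 ≤ r))) j i 0]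
  congr 1
  · field_simp
  · have h : HasFDerivAt (𝕜 := ℝ)
        (fun z => ε⁻¹ * epd i U w + fderiv ℝ (fderiv ℝ U) 0 z (EuclideanSpace.single i 1)) _ z :=
      ((fderiv ℝ (fderiv ℝ U) 0).hasFDerivAt.clm_apply
        (hasFDerivAt_const (EuclideanSpace.single i 1) z)).const_add _
    refine (congrArg (fun L => L (EuclideanSpace.single j 1)) h.fderiv).trans ?_
    simp

theorem pdSum_mayerExponent_of_three_le (hU : ContDiff ℝ r U) (hε : 0 < ε) {k : ℕ}
    (hk : k + 3 ≤ r) (z : EuclideanSpace ℝ ι) :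
    pdSum (k + 3) (mayerExponent U w ε) z = ε ^ (k + 1) * pdSum (k + 3) U (w + ε • z) := by
  have hU3 : ContDiff ℝ (k + 1 + 1 + 1 : ℕ) U := hU.of_le (by exact_mod_cast hk)
  have hij : ∀ i j, pdSum (k + 1) (epd j (epd i (mayerExponent U w ε))) z =
      ε ^ (k + 1) * pdSum (k + 1) (epd j (epd i U)) (w + ε • z) := by
    intro i j
    rw [epd_epd_mayerExponent hU (by omega) hε]
    have := pdSum_const_mul_comp_affine (contDiff_epd (contDiff_epd hU3 i) j) (-1) hε.le w z
    simp only [pdSum] at this ⊢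
    simpa only [epd_add_const, abs_neg, abs_one, one_mul] using this
  calc pdSum (k + 3) (mayerExponent U w ε) z
      = ∑ i, ∑ j, pdSum (k + 1) (epd j (epd i (mayerExponent U w ε))) z := rfl
    _ = ∑ i, ∑ j, ε ^ (k + 1) * pdSum (k + 1) (epd j (epd i U)) (w + ε • z) := by
      simp only [hij]
    _ = ε ^ (k + 1) * ∑ i, ∑ j, pdSum (k + 1) (epd j (epd i U)) (w + ε • z) := by
      simp only [Finset.mul_sum]
    _ = _ := rfl

omit [DecidableEq ι] in
theorem norm_add_smul_le {t : ℝ} (hε : 0 ≤ ε) {z : EuclideanSpace ℝ ι} (hz : ‖z‖ ≤ t) :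
    ‖w + ε • z‖ ≤ ‖w‖ + ε * t := by
  refine (norm_add_le _ _).trans ?_
  rw [norm_smul, Real.norm_eq_abs, abs_of_nonneg hε]
  gcongr

theorem pdSum_two_mayerExponent_le (hU : ContDiff ℝ r U) (hr : 3 ≤ r) (hε : 0 < ε) {t C : ℝ}
    (hC : ∀ x, ‖x‖ ≤ ‖w‖ + ε * t → pdSum 3 U x ≤ C) {z : EuclideanSpace ℝ ι} (hz : ‖z‖ ≤ t) :
    pdSum 2 (mayerExponent U w ε) z ≤ C * (‖w‖ + ε * t) := by
  have hd : ∀ p : ι × ι, Differentiable ℝ (epd p.2 (epd p.1 U)) := fun p =>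
    (contDiff_epd (m := 1) (contDiff_epd (m := 2) (hU.of_le
      (by exact_mod_cast (by omega : 2 + 1 ≤ r))) p.1) p.2).differentiable (by norm_num)
  have hx := norm_add_smul_le (w := w) hε.le hz
  have h := sum_abs_sub_le hd (t := ‖w‖ + ε * t) (C := C) (fun y hy => by
    rw [Fintype.sum_prod_type]
    exact hC y hy) hx
  have hC0 : 0 ≤ C := (pdSum_nonneg _ _ _).trans (hC _ hx)
  refine le_trans (le_of_eq ?_) (h.trans (mul_le_mul_of_nonneg_left hx hC0))
  rw [Fintype.sum_prod_type]
  simp only [pdSum, epd_epd_mayerExponent hU hr hε]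
  refine Finset.sum_congr rfl fun i _ => Finset.sum_congr rfl fun j _ => ?_
  rw [abs_sub_comm]
  congr 1
  ring

theorem pdSum_one_mayerExponent_le (hU : ContDiff ℝ r U) (hr : 3 ≤ r) (hε : 0 < ε) {t C : ℝ}
    (hC : ∀ x, ‖x‖ ≤ ‖w‖ + ε * t → pdSum 3 U x ≤ C) {z : EuclideanSpace ℝ ι} (hz : ‖z‖ ≤ t) :
    pdSum 1 (mayerExponent U w ε) z ≤ C * (‖w‖ + ε * t) * t := by
  have hV := contDiff_mayerExponent hU w ε
  have hd : ∀ i : ι, Differentiable ℝ (epd i (mayerExponent U w ε)) := fun i =>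
    (contDiff_epd (m := 1) (hV.of_le (by exact_mod_cast (by omega : 1 + 1 ≤ r))) i).differentiable
      (by norm_num)
  have h := sum_abs_sub_le hd (t := t) (C := C * (‖w‖ + ε * t))
    (fun y hy => pdSum_two_mayerExponent_le hU hr hε hC hy) hz
  have h0 : ∀ i, epd i (mayerExponent U w ε) 0 = 0 := fun i => by
    rw [epd_mayerExponent hU hr hε]
    simp
  have hnn : 0 ≤ C * (‖w‖ + ε * t) := (pdSum_nonneg _ _ _).trans
    (pdSum_two_mayerExponent_le hU hr hε hC hz)
  simp only [h0, sub_zero] at h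
  exact h.trans (mul_le_mul_of_nonneg_left hz hnn)

theorem abs_mayerExponent_le (hU : ContDiff ℝ r U) (hr : 3 ≤ r) (hε : 0 < ε) {t C : ℝ}
    (hC : ∀ x, ‖x‖ ≤ ‖w‖ + ε * t → pdSum 3 U x ≤ C) {z : EuclideanSpace ℝ ι} (hz : ‖z‖ ≤ t) :
    |mayerExponent U w ε z| ≤ C * (‖w‖ + ε * t) * t ^ 2 := by
  have hV := contDiff_mayerExponent hU w ε
  have h := sum_abs_sub_le (A := Unit) (f := fun _ => mayerExponent U w ε)
    (fun _ => hV.differentiable (by exact_mod_cast (by omega : r ≠ 0)))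
    (t := t) (C := C * (‖w‖ + ε * t) * t)
    (fun y hy => by simpa using pdSum_one_mayerExponent_le hU hr hε hC hy) hz
  have h0 : mayerExponent U w ε 0 = 0 := by simp [mayerExponent, equad0]
  have hnn : 0 ≤ C * (‖w‖ + ε * t) * t := (pdSum_nonneg _ _ _).trans
    (pdSum_one_mayerExponent_le hU hr hε hC hz)
  simp only [h0, sub_zero, Finset.univ_unique, Finset.sum_singleton] at h
  refine h.trans ((mul_le_mul_of_nonneg_left hz hnn).trans (le_of_eq (by ring)))

/-- The radius `δ0`, in terms of the coercivity constants and a bound `C` for the third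
derivatives on the unit ball. -/
noncomputable def mayerRadius (ω ω0 C : ℝ) : ℝ :=
  ω / (4 * (1 + ω0⁻¹ + C)) * (ω0 / (4 * (C + 1))) / 2

theorem mayerRadius_pos {ω ω0 C : ℝ} (hω : 0 < ω) (hω0 : 0 < ω0) (hC : 0 ≤ C) :
    0 < mayerRadius ω ω0 C := by
  unfold mayerRadius
  positivity

theorem mayerRadius_le_one {ω ω0 C : ℝ} (hω1 : ω ≤ 1) (hω0 : 0 < ω0) (hω01 : ω0 ≤ 1)
    (hC : 0 ≤ C) : mayerRadius ω ω0 C ≤ 1 := by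
  have hi : 0 ≤ ω0⁻¹ := by positivity
  have h1 : ω / (4 * (1 + ω0⁻¹ + C)) ≤ 1 := (div_le_one (by positivity)).2 (by linarith)
  have h2 : ω0 / (4 * (C + 1)) ≤ 1 := (div_le_one (by positivity)).2 (by linarith)
  have h3 : 0 ≤ ω0 / (4 * (C + 1)) := by positivity
  unfold mayerRadius
  have := mul_le_one₀ h1 h3 h2
  linarith

theorem le_taylor_remainder {ω ω0 C : ℝ} (hU : ContDiff ℝ r U) (hr : 3 ≤ r)
    (hω : 0 < ω) (hωω0 : ω ≤ ω0 / 8) (hω01 : ω0 < 1)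
    (hQ : ∀ z, ω0 * ‖z‖ ^ 2 ≤ equad0 U z ∧ equad0 U z ≤ ω0⁻¹ * ‖z‖ ^ 2)
    (hlow : ∀ z, ω * ‖z‖ ^ 2 ≤ U z - U 0 - fderiv ℝ U 0 z)
    (hC : ∀ x, ‖x‖ ≤ 1 → pdSum 3 U x ≤ C) (hw : ‖w‖ ≤ mayerRadius ω ω0 C)
    (y : EuclideanSpace ℝ ι) :
    ω / 2 * ‖y‖ ^ 2 ≤ U (w + y) - U w - fderiv ℝ U w y := by
  have hω0 : 0 < ω0 := by linarith
  have hC0 : 0 ≤ C := (pdSum_nonneg _ _ _).trans (hC 0 (by simp))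
  have hi : 0 < ω0⁻¹ := by positivity
  set ρ := ω0 / (4 * (C + 1)) with hρ
  set θ := ω / (4 * (1 + ω0⁻¹ + C)) with hθ
  have hρ0 : 0 < ρ := by positivity
  have hθ0 : 0 < θ := by positivity
  have hρC : ρ * (C + 1) = ω0 / 4 := by rw [hρ]; field_simp
  have hθC : θ * (1 + ω0⁻¹ + C) = ω / 4 := by rw [hθ]; field_simp
  have hρ1 : ρ ≤ 1 := by nlinarith
  have hθ1 : θ ≤ 1 := by nlinarith
  have hw' : ‖w‖ ≤ θ * (ρ / 2) := hw.trans (le_of_eq (by unfold mayerRadius; ring))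
  have hwρ : ‖w‖ ≤ ρ / 2 := hw'.trans (mul_le_of_le_one_left (by positivity) hθ1)
  have hw1 : ‖w‖ ≤ 1 := by linarith
  have ha := norm_nonneg y
  have hb := norm_nonneg w
  rcases le_total (‖w‖ + ‖y‖) ρ with hcase | hcase
  · have hV := abs_mayerExponent_le (w := w) (ε := 1) (t := ‖y‖) (C := C) (z := y) hU hr one_pos
      (fun x hx => hC x (hx.trans (by linarith))) le_rfl
    have hV2 : C * (‖w‖ + 1 * ‖y‖) * ‖y‖ ^ 2 ≤ ω0 / 4 * ‖y‖ ^ 2 := by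
      refine mul_le_mul_of_nonneg_right ?_ (by positivity)
      nlinarith
    have hV3 := (abs_le.1 (hV.trans hV2)).2
    simp only [mayerExponent, one_smul, one_pow, inv_one] at hV3
    have := (hQ y).1
    nlinarith [sq_nonneg ‖y‖]
  · have hba : ‖w‖ ≤ θ * ‖y‖ := hw'.trans (by gcongr; linarith)
    set B := fderiv ℝ (fderiv ℝ U) 0 with hB
    have hsplit : U (w + y) - U w - fderiv ℝ U w y =
        (U (w + y) - U 0 - fderiv ℝ U 0 (w + y)) - (U w - U 0 - fderiv ℝ U 0 w) -
          (fderiv ℝ U w y - fderiv ℝ U 0 y) := by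
      rw [map_add]; ring
    have hCw : ∀ x, ‖x‖ ≤ ‖(0 : EuclideanSpace ℝ ι)‖ + 1 * ‖w‖ → pdSum 3 U x ≤ C := fun x hx =>
      hC x (hx.trans (by simpa using hw1))
    have hF := (abs_le.1 (abs_mayerExponent_le (w := 0) hU hr one_pos hCw (z := w) le_rfl)).1
    have hDF := (abs_le.1 ((abs_fderiv_le_pdSum (mayerExponent U 0 1) w y).trans
      (mul_le_mul_of_nonneg_right (pdSum_one_mayerExponent_le (w := 0) hU hr one_pos hCw
        (z := w) le_rfl) ha))).1
    rw [fderiv_mayerExponent_apply hU hr one_pos] at hDF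
    simp only [mayerExponent, one_smul, one_pow, inv_one, zero_add, norm_zero, one_mul, ← hB]
      at hF hDF
    have hBwy : B w y ≤ θ * ‖y‖ ^ 2 * ω0⁻¹ := by
      have h0 : 0 ≤ equad0 U (w - θ • y) := le_trans (by positivity) (hQ _).1
      have h1 : equad0 U (w - θ • y) = equad0 U w - 2 * θ * B w y + θ ^ 2 * equad0 U y := by
        simp only [equad0, map_sub, map_smul, sub_apply, smul_apply, smul_eq_mul, ← hB]
        rw [fderiv_fderiv_comm hU hr y w]
        ring
      have h2 : equad0 U w ≤ ω0⁻¹ * (θ * ‖y‖) ^ 2 := (hQ w).2.trans (by gcongr)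
      have h3 : θ ^ 2 * equad0 U y ≤ θ ^ 2 * (ω0⁻¹ * ‖y‖ ^ 2) := by gcongr; exact (hQ y).2
      have h4 : θ * B w y ≤ θ * (θ * ‖y‖ ^ 2 * ω0⁻¹) := by linarith
      exact le_of_mul_le_mul_left h4 hθ0
    have hsq : ‖w‖ ^ 2 ≤ θ * ‖y‖ ^ 2 := by
      calc ‖w‖ ^ 2 ≤ (θ * ‖y‖) ^ 2 := by gcongr
        _ = θ * (θ * ‖y‖ ^ 2) := by ring
        _ ≤ 1 * (θ * ‖y‖ ^ 2) := by gcongr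
        _ = _ := one_mul _
    have e1 : equad0 U w / 2 ≤ ω0⁻¹ * (θ * ‖y‖ ^ 2) / 2 := by
      have := (hQ w).2.trans (mul_le_mul_of_nonneg_left hsq hi.le)
      linarith
    have e2 : C * ‖w‖ * ‖w‖ ^ 2 ≤ C * (θ * ‖y‖ ^ 2) :=
      mul_le_mul (mul_le_of_le_one_right hC0 hw1) hsq (by positivity) hC0
    have e3 : C * ‖w‖ * ‖w‖ * ‖y‖ ≤ C * (θ * ‖y‖ ^ 2) := by
      calc C * ‖w‖ * ‖w‖ * ‖y‖ ≤ C * 1 * (θ * ‖y‖) * ‖y‖ := by gcongr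
        _ = _ := by ring
    have e4 : (1 - 2 * θ) * ‖y‖ ^ 2 ≤ ‖w + y‖ ^ 2 := by
      have h1 : ‖y‖ ≤ ‖w + y‖ + ‖w‖ := by simpa using norm_sub_le (w + y) w
      have h2 : (1 - θ) * ‖y‖ ≤ ‖w + y‖ := by linarith
      have h3 : ((1 - θ) * ‖y‖) ^ 2 ≤ ‖w + y‖ ^ 2 :=
        pow_le_pow_left₀ (mul_nonneg (by linarith) ha) h2 2
      linarith [sq_nonneg (θ * ‖y‖)]
    have e5 := hlow (w + y)
    have e6 := mul_le_mul_of_nonneg_left e4 hω.le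
    have e7 : θ * (2 * ω + 2 * ω0⁻¹ + 2 * C) ≤ ω / 2 := by
      have := mul_le_mul_of_nonneg_left (by linarith : ω ≤ 1) hθ0.le
      linarith
    have e8 := mul_le_mul_of_nonneg_right e7 (sq_nonneg ‖y‖)
    have e9 : 0 ≤ ω0⁻¹ * (θ * ‖y‖ ^ 2) := by positivity
    rw [hsplit]
    linarith

theorem abs_exp_sub_one_le_mul (x : ℝ) : |Real.exp x - 1| ≤ |x| * (1 + Real.exp x) := by
  have hx := Real.exp_pos x
  rcases le_total 0 x with h | h
  · rw [abs_of_nonneg h, abs_of_nonneg (by linarith [Real.add_one_le_exp x])]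
    have h1 := mul_le_mul_of_nonneg_right (Real.add_one_le_exp (-x)) hx.le
    rw [← Real.exp_add, neg_add_cancel, Real.exp_zero] at h1
    nlinarith
  · rw [abs_of_nonpos h, abs_of_nonpos (by linarith [Real.exp_le_one_iff.2 h])]
    have := Real.add_one_le_exp x
    nlinarith

theorem etaylorNorm_exp_sub_one_le {f : EuclideanSpace ℝ ι → ℝ} (hf : ContDiff ℝ r f)
    {z : EuclideanSpace ℝ ι} {M : ℝ} (hfM : ∀ j ≤ r, pdSum j f z ≤ M) :
    etaylorNorm r (fun z => Real.exp (f z) - 1) z ≤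
      (r + 1 : ℕ) * r.factorial * (M * (1 + M) ^ r) * (1 + Real.exp (f z)) := by
  have hM : 0 ≤ M := (pdSum_nonneg _ _ _).trans (hfM 0 (Nat.zero_le _))
  have h1M : 1 ≤ 1 + M := by linarith
  have hfac : (1 : ℝ) ≤ r.factorial := by exact_mod_cast Nat.succ_le_of_lt r.factorial_pos
  refine (etaylorNorm_le_sum_pdSum (hf.exp.sub contDiff_const) z).trans ?_
  have hterm : ∀ k ∈ Finset.range (r + 1), pdSum k (fun z => Real.exp (f z) - 1) z ≤
      r.factorial * (M * (1 + M) ^ r) * (1 + Real.exp (f z)) := by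
    intro k hk
    have hkr : k ≤ r := by simpa [Nat.lt_succ_iff] using hk
    cases k with
    | zero =>
      refine (abs_exp_sub_one_le_mul (f z)).trans ?_
      refine mul_le_mul_of_nonneg_right ?_ (by positivity)
      calc |f z| ≤ 1 * (M * 1) := by simpa [pdSum] using hfM 0 (Nat.zero_le _)
        _ ≤ r.factorial * (M * (1 + M) ^ r) := by
          gcongr
          exact one_le_pow₀ h1M
    | succ k =>
      have h := pdSum_succ_exp_le hf hM (fun j hj => hfM (j + 1) hj) hkr
      have heq : pdSum (k + 1) (fun z => Real.exp (f z) - 1) z =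
          pdSum (k + 1) (fun z => Real.exp (f z)) z := by
        simp only [sub_eq_add_neg, pdSum, epd_add_const]
      rw [heq]
      refine h.trans ?_
      gcongr
      · omega
      · linarith
  refine (Finset.sum_le_card_nsmul _ _ _ hterm).trans (le_of_eq ?_)
  rw [Finset.card_range, nsmul_eq_mul]
  ring

theorem exists_le_exp_of_tendsto_log {Ψ : ℝ → ℝ} (hmono : MonotoneOn Ψ (Set.Ici 0))
    (hnn : ∀ t, 0 ≤ t → 0 ≤ Ψ t)
    (hlim : Filter.Tendsto (fun t : ℝ => Real.log (Ψ t) / t ^ 2) Filter.atTop (nhds 0))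
    {η : ℝ} (hη : 0 < η) :
    ∃ c, 0 ≤ c ∧ ∀ t, 0 ≤ t → (1 + t) ^ 3 * Ψ (1 + t) ≤ c * Real.exp (η * t ^ 2) := by
  obtain ⟨T, hT⟩ := Filter.eventually_atTop.1
    ((hlim.eventually (gt_mem_nhds (by positivity : (0 : ℝ) < η / 4))))
  set S := max T 1 with hS
  have hS1 : 1 ≤ S := le_max_right _ _
  have hΨS := hnn S (by linarith)
  have hΨ : ∀ t, 0 ≤ t → Ψ (1 + t) ≤ (Ψ S + Real.exp (η / 2)) * Real.exp (η / 2 * t ^ 2) := by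
    intro t ht
    have he1 : 1 ≤ Real.exp (η / 2 * t ^ 2) := Real.one_le_exp (by positivity)
    rcases le_total (1 + t) S with h | h
    · have h1 := hmono (show (0 : ℝ) ≤ 1 + t by linarith) (show (0 : ℝ) ≤ S by linarith) h
      calc Ψ (1 + t) ≤ Ψ S * 1 := by linarith
        _ ≤ _ := by
          gcongr
          linarith [Real.exp_pos (η / 2)]
    · have h1 := hT (1 + t) ((le_max_left _ _).trans h)
      have h2 : Real.log (Ψ (1 + t)) ≤ η / 4 * (1 + t) ^ 2 :=
        ((div_lt_iff₀ (by positivity)).1 h1).le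
      have h3 : Ψ (1 + t) ≤ Real.exp (η / 4 * (1 + t) ^ 2) := by
        rcases (hnn (1 + t) (by linarith)).eq_or_lt with h0 | h0
        · rw [← h0]; positivity
        · exact (Real.log_le_iff_le_exp h0).1 h2
      have h4 : Real.exp (η / 4 * (1 + t) ^ 2) ≤ Real.exp (η / 2) * Real.exp (η / 2 * t ^ 2) := by
        rw [← Real.exp_add]
        exact Real.exp_le_exp.2 (by nlinarith [sq_nonneg (1 - t)])
      refine h3.trans (h4.trans ?_)
      gcongr
      linarith
  have hpoly : ∀ t, 0 ≤ t →
      (1 + t) ^ 3 ≤ 4 * (1 + 4 / η) ^ 2 * Real.exp (η / 2 * t ^ 2) := by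
    intro t ht
    have he : η / 4 * t ^ 2 + 1 ≤ Real.exp (η / 4 * t ^ 2) := Real.add_one_le_exp _
    have h1 : 1 + t ^ 2 ≤ (1 + 4 / η) * Real.exp (η / 4 * t ^ 2) := by
      calc 1 + t ^ 2 ≤ (1 + 4 / η) * (η / 4 * t ^ 2 + 1) := by
            have : (1 + 4 / η) * (η / 4 * t ^ 2 + 1) =
              1 + t ^ 2 + (η / 4 * t ^ 2 + 4 / η) := by field_simp; ring
            rw [this]
            have : 0 ≤ η / 4 * t ^ 2 + 4 / η := by positivity
            linarith
        _ ≤ _ := by gcongr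
    calc (1 + t) ^ 3 ≤ (1 + t) ^ 4 := pow_le_pow_right₀ (by linarith) (by norm_num)
      _ = ((1 + t) ^ 2) ^ 2 := by ring
      _ ≤ (2 * (1 + t ^ 2)) ^ 2 := by
          gcongr
          nlinarith [sq_nonneg (1 - t)]
      _ ≤ (2 * ((1 + 4 / η) * Real.exp (η / 4 * t ^ 2))) ^ 2 := by gcongr
      _ = 4 * (1 + 4 / η) ^ 2 * (Real.exp (η / 4 * t ^ 2) * Real.exp (η / 4 * t ^ 2)) := by ring
      _ = _ := by
          rw [← Real.exp_add]
          ring_nf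
  refine ⟨4 * (1 + 4 / η) ^ 2 * (Ψ S + Real.exp (η / 2)), by positivity, fun t ht => ?_⟩
  calc (1 + t) ^ 3 * Ψ (1 + t) ≤ (4 * (1 + 4 / η) ^ 2 * Real.exp (η / 2 * t ^ 2)) *
        ((Ψ S + Real.exp (η / 2)) * Real.exp (η / 2 * t ^ 2)) :=
        mul_le_mul (hpoly t ht) (hΨ t ht) (hnn _ (by linarith)) (by positivity)
    _ = 4 * (1 + 4 / η) ^ 2 * (Ψ S + Real.exp (η / 2)) *
        (Real.exp (η / 2 * t ^ 2) * Real.exp (η / 2 * t ^ 2)) := by ring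
    _ = _ := by
        rw [← Real.exp_add]
        ring_nf

theorem exists_gaussian_bound (ω : ℝ) (r : ℕ) (Ψ : ℝ → ℝ) :
    ∃ C, 0 < C ∧ (0 < ω → MonotoneOn Ψ (Set.Ici 0) → (∀ t, 0 ≤ t → 0 ≤ Ψ t) →
      Filter.Tendsto (fun t : ℝ => Real.log (Ψ t) / t ^ 2) Filter.atTop (nhds 0) →
      ∀ t, 0 ≤ t → ∀ G, G = r.factorial * ((1 + t) ^ 3 * Ψ (1 + t)) →
        G * (1 + 2 * G) ^ r ≤ C * Real.exp (ω / 4 * t ^ 2)) := by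
  by_cases h : 0 < ω ∧ MonotoneOn Ψ (Set.Ici 0) ∧ (∀ t, 0 ≤ t → 0 ≤ Ψ t) ∧
      Filter.Tendsto (fun t : ℝ => Real.log (Ψ t) / t ^ 2) Filter.atTop (nhds 0)
  · obtain ⟨hω, hmono, hnn, hlim⟩ := h
    obtain ⟨c, hc, hbound⟩ := exists_le_exp_of_tendsto_log hmono hnn hlim
      (η := ω / (4 * (r + 1))) (by positivity)
    refine ⟨(1 + 2 * (r.factorial * c)) ^ (r + 1), by positivity, fun _ _ _ _ t ht G hG => ?_⟩
    set e := Real.exp (ω / (4 * (r + 1)) * t ^ 2) with he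
    have he1 : 1 ≤ e := Real.one_le_exp (by positivity)
    have hG0 : 0 ≤ G := by
      rw [hG]
      have := hnn (1 + t) (by linarith)
      positivity
    have hGe : 1 + 2 * G ≤ (1 + 2 * (r.factorial * c)) * e := by
      have : G ≤ r.factorial * (c * e) := by
        rw [hG]
        exact mul_le_mul_of_nonneg_left (hbound t ht) (by positivity)
      linarith
    calc G * (1 + 2 * G) ^ r ≤ (1 + 2 * G) * (1 + 2 * G) ^ r := by gcongr; linarith
      _ = (1 + 2 * G) ^ (r + 1) := by ring
      _ ≤ ((1 + 2 * (r.factorial * c)) * e) ^ (r + 1) := by gcongr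
      _ = _ := by
        rw [mul_pow, he, ← Real.exp_nat_mul]
        congr 2
        push_cast
        field_simp
  · exact ⟨1, one_pos, fun h1 h2 h3 h4 => absurd ⟨h1, h2, h3, h4⟩ h⟩

/-- The sum of the normalised derivatives of orders `3` to `r`, whose supremum over balls is `Ψ`. -/
noncomputable def highTaylorNorm (r : ℕ) (U : EuclideanSpace ℝ ι → ℝ)
    (z : EuclideanSpace ℝ ι) : ℝ :=
  ∑ α ∈ (Finset.Iic (fun _ : ι => r)).filter (fun α => 3 ≤ ∑ i, α i ∧ ∑ i, α i ≤ r),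
    |epdMulti α U z| / ((emfact α : ℕ) : ℝ)

theorem highTaylorNorm_nonneg (z : EuclideanSpace ℝ ι) : 0 ≤ highTaylorNorm r U z :=
  Finset.sum_nonneg fun _ _ => by positivity

theorem continuous_highTaylorNorm (hU : ContDiff ℝ r U) : Continuous (highTaylorNorm r U) := by
  refine continuous_finsetSum _ fun α hα => ?_
  have h := (Finset.mem_filter.1 hα).2.2
  have hc : Continuous (epdMulti α U) := by
    rw [epdMulti_eq_pdList]
    refine (contDiff_pdList (m := 0) _ (hU.of_le ?_)).continuous
    rw [length_multiList, zero_add]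
    exact_mod_cast h
  exact hc.abs.div_const _

section Envelope

variable {Ψ : ℝ → ℝ}

theorem highTaylorNorm_le (hU : ContDiff ℝ r U)
    (hΨ : ∀ t, Ψ t = sSup {y | ∃ z, ‖z‖ ≤ t ∧ y = highTaylorNorm r U z})
    {t : ℝ} {z : EuclideanSpace ℝ ι} (hz : ‖z‖ ≤ t) : highTaylorNorm r U z ≤ Ψ t := by
  rw [hΨ]
  refine le_csSup ?_ ⟨z, hz, rfl⟩
  refine ((isCompact_closedBall (0 : EuclideanSpace ℝ ι) t).image
    (continuous_highTaylorNorm hU)).bddAbove.mono ?_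
  rintro _ ⟨x, hx, rfl⟩
  exact ⟨x, by simpa using hx, rfl⟩

theorem envelope_nonneg (hU : ContDiff ℝ r U)
    (hΨ : ∀ t, Ψ t = sSup {y | ∃ z, ‖z‖ ≤ t ∧ y = highTaylorNorm r U z})
    (t : ℝ) (ht : 0 ≤ t) : 0 ≤ Ψ t :=
  (highTaylorNorm_nonneg 0).trans (highTaylorNorm_le hU hΨ (by simpa using ht))

theorem envelope_monotoneOn (hU : ContDiff ℝ r U)
    (hΨ : ∀ t, Ψ t = sSup {y | ∃ z, ‖z‖ ≤ t ∧ y = highTaylorNorm r U z}) :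
    MonotoneOn Ψ (Set.Ici 0) := by
  intro s hs t _ hst
  rw [hΨ s]
  refine csSup_le ⟨_, 0, by simpa using hs, rfl⟩ ?_
  rintro _ ⟨x, hx, rfl⟩
  exact highTaylorNorm_le hU hΨ (hx.trans hst)

theorem pdSum_le_envelope (hU : ContDiff ℝ r U)
    (hΨ : ∀ t, Ψ t = sSup {y | ∃ z, ‖z‖ ≤ t ∧ y = highTaylorNorm r U z})
    {k : ℕ} (hk : 3 ≤ k) (hkr : k ≤ r) {t : ℝ} {z : EuclideanSpace ℝ ι} (hz : ‖z‖ ≤ t) :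
    pdSum k U z ≤ k.factorial * Ψ t :=
  (pdSum_le_sum_epdMulti hk hkr hU z).trans
    (mul_le_mul_of_nonneg_left (highTaylorNorm_le hU hΨ hz) (by positivity))

theorem pdSum_mayerExponent_le (hU : ContDiff ℝ r U) (hr : 3 ≤ r)
    (hΨ : ∀ t, Ψ t = sSup {y | ∃ z, ‖z‖ ≤ t ∧ y = highTaylorNorm r U z})
    (hε : 0 < ε) (hε1 : ε ≤ 1) {δ : ℝ} (hδ1 : δ ≤ 1) (hw : ‖w‖ ≤ δ) (z : EuclideanSpace ℝ ι)
    {k : ℕ} (hk : k ≤ r) :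
    pdSum k (mayerExponent U w ε) z ≤
      (δ + ε) * (r.factorial * ((1 + ‖z‖) ^ 3 * Ψ (1 + ‖z‖))) := by
  set t := ‖z‖ with ht
  have ht0 : 0 ≤ t := norm_nonneg z
  have hδ : 0 ≤ δ := (norm_nonneg w).trans hw
  set P := Ψ (1 + t) with hP
  have hP0 : 0 ≤ P := envelope_nonneg hU hΨ _ (by linarith)
  have hεt : ε * t ≤ t := mul_le_of_le_one_left ht0 hε1
  have hR1 : ‖w‖ + ε * t ≤ 1 + t := by linarith
  have hR : ‖w‖ + ε * t ≤ (δ + ε) * (1 + t) := by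
    have := mul_nonneg hδ ht0
    linarith
  have hfac : ∀ {j : ℕ}, 3 ≤ j → j ≤ r → ∀ x, ‖x‖ ≤ ‖w‖ + ε * t →
      pdSum j U x ≤ r.factorial * P := fun hj hjr x hx =>
    (pdSum_le_envelope hU hΨ hj hjr (hx.trans hR1)).trans (by
      gcongr)
  have hC := hfac le_rfl hr
  have hlow : ∀ j ≤ 2, r.factorial * P * (‖w‖ + ε * t) * t ^ j ≤
      (δ + ε) * (r.factorial * ((1 + t) ^ 3 * P)) := by
    intro j hj
    calc r.factorial * P * (‖w‖ + ε * t) * t ^ j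
        ≤ r.factorial * P * ((δ + ε) * (1 + t)) * (1 + t) ^ 2 := by
          gcongr
          calc t ^ j ≤ (1 + t) ^ j := by gcongr; linarith
            _ ≤ (1 + t) ^ 2 := pow_le_pow_right₀ (by linarith) hj
      _ = _ := by ring
  match k, hk with
  | 0, _ => exact (abs_mayerExponent_le hU hr hε hC le_rfl).trans (hlow 2 le_rfl)
  | 1, _ =>
    exact (pdSum_one_mayerExponent_le hU hr hε hC le_rfl).trans (by simpa using hlow 1 (by norm_num))
  | 2, _ =>
    exact (pdSum_two_mayerExponent_le hU hr hε hC le_rfl).trans (by simpa using hlow 0 (by norm_num))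
  | k + 3, hk =>
    rw [pdSum_mayerExponent_of_three_le hU hε hk]
    have h1 : ε ^ (k + 1) ≤ δ + ε := by
      rw [pow_succ]
      have := mul_le_of_le_one_left hε.le (pow_le_one₀ hε.le hε1 (n := k))
      linarith
    refine mul_le_mul h1 ?_ (pdSum_nonneg _ _ _) (by linarith)
    refine (hfac (by omega) hk _ (norm_add_smul_le hε.le le_rfl)).trans ?_
    gcongr
    exact le_mul_of_one_le_left hP0 (one_le_pow₀ (by linarith))

end Envelope

omit [DecidableEq ι] in
theorem exp_mul_one_add_exp_mayerExponent_le {ω ω0 : ℝ} (hω : 0 < ω) (hωω0 : ω ≤ ω0 / 8)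
    (hω01 : ω0 < 1)
    (hQ : ∀ z, ω0 * ‖z‖ ^ 2 ≤ equad0 U z ∧ equad0 U z ≤ ω0⁻¹ * ‖z‖ ^ 2) (hε : 0 < ε)
    (hlow : ∀ y, ω / 2 * ‖y‖ ^ 2 ≤ U (w + y) - U w - fderiv ℝ U w y) (z : EuclideanSpace ℝ ι) :
    Real.exp (-((1 - ω * ω0 / 2) * equad0 U z) / 2) * (1 + Real.exp (mayerExponent U w ε z)) ≤
      2 * Real.exp (-(ω / 4 * ‖z‖ ^ 2)) := by
  have hω0 : 0 < ω0 := by linarith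
  have hz := sq_nonneg ‖z‖
  have hζ : ω * ω0 ≤ 1 / 8 := by nlinarith
  obtain ⟨hQ1, hQ2⟩ := hQ z
  have hQ0 : 0 ≤ equad0 U z := le_trans (by positivity) hQ1
  have h1 : -((1 - ω * ω0 / 2) * equad0 U z) / 2 ≤ -(ω / 4 * ‖z‖ ^ 2) := by
    have e1 := mul_le_mul_of_nonneg_right hζ hQ0
    have e2 := mul_le_mul_of_nonneg_right hωω0 hz
    linarith
  have h2 : -((1 - ω * ω0 / 2) * equad0 U z) / 2 + mayerExponent U w ε z ≤
      -(ω / 4 * ‖z‖ ^ 2) := by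
    have e1 : ω / 2 * ‖z‖ ^ 2 ≤
        (ε ^ 2)⁻¹ * (U (w + ε • z) - U w - fderiv ℝ U w (ε • z)) := by
      have e := mul_le_mul_of_nonneg_left (hlow (ε • z)) (by positivity : 0 ≤ (ε ^ 2)⁻¹)
      rw [norm_smul, Real.norm_eq_abs, abs_of_pos hε] at e
      refine le_trans (le_of_eq ?_) e
      field_simp
    have e2 : ω * ω0 * equad0 U z ≤ ω * ‖z‖ ^ 2 := by
      calc ω * ω0 * equad0 U z ≤ ω * ω0 * (ω0⁻¹ * ‖z‖ ^ 2) := by gcongr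
        _ = _ := by field_simp
    unfold mayerExponent
    linarith
  rw [mul_add, mul_one, ← Real.exp_add]
  linarith [Real.exp_le_exp.2 h1, Real.exp_le_exp.2 h2]

end PartialDerivatives

theorem Kpert_eq_exp_mayerExponent {n : ℕ} (U : EuclideanSpace ℝ (Fin n) → ℝ)
    (w : EuclideanSpace ℝ (Fin n)) {β : ℝ} (hβ : 0 ≤ β) :
    Kpert U w β = fun z => Real.exp (mayerExponent U w (Real.sqrt β)⁻¹ z) - 1 := by
  funext z
  simp only [Kpert, mayerExponent, inv_pow, inv_inv, Real.sq_sqrt hβ]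

/-- Smallness of the Mayer perturbation in the weighted Taylor norm:
`sup_z e^{−(1−ζ̃)Q_U(z)/2} |K_{w,β}|_{T_z} ≤ C1 (δ + β^{−1/2})` for `|w| ≤ δ ≤ δ0`, `β ≥ 1`,
where `ζ̃ = ωω0/2`, `δ0 = δ0(ω, ω0, Ψ(1))` and `C1 = C1(ω, r0, Ψ)`. -/
theorem stmt4 :
    ∃ (δ0 : ℝ → ℝ → ℝ → ℝ) (C1 : ℝ → ℕ → (ℝ → ℝ) → ℝ),
      ∀ (n r0 : ℕ) (U : EuclideanSpace ℝ (Fin n) → ℝ) (ω ω0 : ℝ) (Ψ : ℝ → ℝ),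
        3 ≤ r0 →
        ContDiff ℝ r0 U →
        0 < ω0 → ω0 < 1 →
        (∀ z : EuclideanSpace ℝ (Fin n),
          ω0 * ‖z‖ ^ 2 ≤ equad0 U z ∧ equad0 U z ≤ ω0⁻¹ * ‖z‖ ^ 2) →
        0 < ω → ω ≤ ω0 / 8 →
        (∀ z : EuclideanSpace ℝ (Fin n), ω * ‖z‖ ^ 2 ≤ U z - U 0 - fderiv ℝ U 0 z) →
        (∀ t : ℝ, Ψ t = sSup {y : ℝ | ∃ z : EuclideanSpace ℝ (Fin n), ‖z‖ ≤ t ∧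
            y = ∑ α ∈ (Finset.Iic (fun _ : Fin n => r0)).filter
                  (fun α => 3 ≤ ∑ i, α i ∧ ∑ i, α i ≤ r0),
                |epdMulti α U z| / ((emfact α : ℕ) : ℝ)}) →
        Filter.Tendsto (fun t : ℝ => Real.log (Ψ t) / t ^ 2) Filter.atTop (nhds 0) →
        (0 < δ0 ω ω0 (Ψ 1) ∧ 0 < C1 ω r0 Ψ ∧
          ∀ δ : ℝ, 0 < δ → δ ≤ δ0 ω ω0 (Ψ 1) → ∀ β : ℝ, 1 ≤ β →
            ∀ w : EuclideanSpace ℝ (Fin n), ‖w‖ ≤ δ →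
              ∀ z : EuclideanSpace ℝ (Fin n),
                Real.exp (-((1 - ω * ω0 / 2) * equad0 U z) / 2) *
                    etaylorNorm r0 (Kpert U w β) z
                  ≤ C1 ω r0 Ψ * (δ + (Real.sqrt β)⁻¹)) := by
  choose c hc hbound using exists_gaussian_bound
  refine ⟨fun ω ω0 p => mayerRadius ω ω0 (6 * p),
    fun ω r Ψ => 2 * ((r + 1 : ℕ) * r.factorial) * c ω r Ψ, ?_⟩
  intro n r U ω ω0 Ψ hr hU hω0 hω01 hQ hω hωω0 hlow hΨ hlim
  replace hΨ : ∀ t, Ψ t = sSup {y | ∃ z, ‖z‖ ≤ t ∧ y = highTaylorNorm r U z} := hΨ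
  have hnn := envelope_nonneg hU hΨ
  have hΨ1 : 0 ≤ 6 * Ψ 1 := by linarith [hnn 1 zero_le_one]
  have hcpos := hc ω r Ψ
  refine ⟨mayerRadius_pos hω hω0 hΨ1, by positivity, ?_⟩
  intro δ hδ hδ0 β hβ w hw z
  have hδ1 : δ ≤ 1 := hδ0.trans (mayerRadius_le_one (by linarith) hω0 hω01.le hΨ1)
  have hε : 0 < (Real.sqrt β)⁻¹ := by positivity
  have hε1 : (Real.sqrt β)⁻¹ ≤ 1 := inv_le_one_of_one_le₀ (Real.one_le_sqrt.2 hβ)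
  rw [Kpert_eq_exp_mayerExponent U w (by linarith)]
  set ε := (Real.sqrt β)⁻¹
  set G := (r.factorial : ℝ) * ((1 + ‖z‖) ^ 3 * Ψ (1 + ‖z‖)) with hG
  have hG0 : 0 ≤ G := by
    have := hnn (1 + ‖z‖) (by positivity)
    positivity
  have hrem := le_taylor_remainder hU hr hω hωω0 hω01 hQ hlow (C := 6 * Ψ 1)
    (fun x hx => by simpa [Nat.factorial] using pdSum_le_envelope hU hΨ le_rfl hr hx)
    (hw.trans hδ0)
  have hT := etaylorNorm_exp_sub_one_le (contDiff_mayerExponent hU w ε) (z := z)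
    (M := (δ + ε) * G) fun j hj => pdSum_mayerExponent_le hU hr hΨ hε hε1 hδ1 hw z hj
  have hE := exp_mul_one_add_exp_mayerExponent_le hω hωω0 hω01 hQ hε hrem z
  have hB := hbound ω r Ψ hω (envelope_monotoneOn hU hΨ) hnn hlim ‖z‖ (norm_nonneg z) G hG
  have hM : (δ + ε) * G * (1 + (δ + ε) * G) ^ r ≤
      (δ + ε) * (c ω r Ψ * Real.exp (ω / 4 * ‖z‖ ^ 2)) := by
    rw [mul_assoc]
    refine mul_le_mul_of_nonneg_left (le_trans ?_ hB) (by positivity)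
    gcongr
    linarith
  calc Real.exp (-((1 - ω * ω0 / 2) * equad0 U z) / 2) *
        etaylorNorm r (fun z => Real.exp (mayerExponent U w ε z) - 1) z
      ≤ Real.exp (-((1 - ω * ω0 / 2) * equad0 U z) / 2) *
        ((r + 1 : ℕ) * r.factorial * ((δ + ε) * G * (1 + (δ + ε) * G) ^ r) *
          (1 + Real.exp (mayerExponent U w ε z))) := by gcongr
    _ = (r + 1 : ℕ) * r.factorial * ((δ + ε) * G * (1 + (δ + ε) * G) ^ r) *
        (Real.exp (-((1 - ω * ω0 / 2) * equad0 U z) / 2) *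
          (1 + Real.exp (mayerExponent U w ε z))) := by ring
    _ ≤ (r + 1 : ℕ) * r.factorial * ((δ + ε) * (c ω r Ψ * Real.exp (ω / 4 * ‖z‖ ^ 2))) *
        (2 * Real.exp (-(ω / 4 * ‖z‖ ^ 2))) := by gcongr
    _ = 2 * ((r + 1 : ℕ) * r.factorial) * c ω r Ψ * (δ + ε) *
        (Real.exp (ω / 4 * ‖z‖ ^ 2) * Real.exp (-(ω / 4 * ‖z‖ ^ 2))) := by ring
    _ = _ := by rw [← Real.exp_add, add_neg_cancel, Real.exp_zero, mul_one]
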